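/- Let T be a finite tree with at least one vertex of degree at least 3, and let a be its number of leaves. Let U be the subgraph of T consisting of the trunk T° together with, for each twig of T, the edge of that twig incident to its endpoint lying on T°. Then U is a subtree of T with exactly a leaves, and every subtree of T with exactly a leaves contains U; in particular, U is the unique subtree of T with a leaves having the minimum number of vertices. -/

import Mathlib

open scoped Classical

noncomputable section

variable {V : Type*}

/-- A coloring `κ : V → ℕ` is proper if adjacent vertices get distinct colors. -/
def Proper (G : SimpleGraph V) (κ : V → ℕ) : Prop :=
  ∀ ⦃u v : V⦄, G.Adj u v → κ u ≠ κ v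

/-- The chromatic symmetric function of `G`, as a formal power series in the
variables `x_0, x_1, x_2, …`: the coefficient of the monomial `∏ i, x_i ^ m i`
is the number of proper colorings `κ : V → ℕ` using color `i` exactly `m i` times. -/
def csf [Fintype V] (G : SimpleGraph V) : MvPowerSeries ℕ ℤ :=
  fun m => (Nat.card {κ : V → ℕ // Proper G κ ∧ ∀ i : ℕ, Nat.card {v : V // κ v = i} = m i} : ℤ)

/-- `A` is (the vertex set of) a subtree of `T`: the induced subgraph on `A` is
connected and has at least one edge. -/
def IsSubtree [Fintype V] (T : SimpleGraph V) (A : Finset V) : Prop :=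
  (T.induce (A : Set V)).Connected ∧ ∃ u ∈ A, ∃ v ∈ A, T.Adj u v

/-- The number of edges of the subgraph of `T` induced on `A`. -/
def edgeCount [Fintype V] (T : SimpleGraph V) (A : Finset V) : ℕ :=
  Nat.card (T.induce (A : Set V)).edgeSet

/-- The number of leaves (vertices of degree 1) of the subgraph of `T` induced on `A`. -/
def leafCount [Fintype V] (T : SimpleGraph V) (A : Finset V) : ℕ :=
  Nat.card {v : (A : Set V) // Nat.card ((T.induce (A : Set V)).neighborSet v) = 1}

/-- The bivariate subtree polynomial `S_T(q, r) = ∑_{subtrees S of T} q^{|E(S)|} r^{|L(S)|}`,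
with `q = X 0` and `r = X 1`. -/
def subtreePoly [Fintype V] (T : SimpleGraph V) : MvPolynomial (Fin 2) ℤ :=
  ∑ A ∈ Finset.univ.powerset.filter (fun A => IsSubtree T A),
    MvPolynomial.X 0 ^ edgeCount T A * MvPolynomial.X 1 ^ leafCount T A

/-- The degree sequence of `T`, as a multiset. -/
def degreeSequence [Fintype V] (T : SimpleGraph V) : Multiset ℕ :=
  Finset.univ.val.map (fun v => T.degree v)

/-- The set of leaves (vertices of degree 1) of `T`. -/
def leaves [Fintype V] (T : SimpleGraph V) : Finset V :=
  Finset.univ.filter (fun v => T.degree v = 1)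

/-- `A` is (the vertex set of) the trunk of `T`: the smallest connected induced
subgraph of `T` containing every vertex of degree at least 3. -/
def IsTrunk [Fintype V] (T : SimpleGraph V) (A : Finset V) : Prop :=
  (T.induce (A : Set V)).Connected ∧ (∀ v : V, 3 ≤ T.degree v → v ∈ A) ∧
    ∀ B : Finset V, (T.induce (B : Set V)).Connected → (∀ v : V, 3 ≤ T.degree v → v ∈ B) →
      A ⊆ B

/-- Every interior (non-endpoint) vertex of the walk `P` has degree 2 in `T`. -/
def InteriorDeg2 [Fintype V] (T : SimpleGraph V) {a b : V} (P : T.Walk a b) : Prop :=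
  ∀ v ∈ P.support, v ≠ a → v ≠ b → T.degree v = 2

/-- `P` is the twig of `l`: the longest path in `T` containing `l` all of whose
interior vertices have degree 2 in `T`. -/
def IsTwig [Fintype V] (T : SimpleGraph V) (l : V) {a b : V} (P : T.Walk a b) : Prop :=
  P.IsPath ∧ l ∈ P.support ∧ InteriorDeg2 T P ∧
    ∀ ⦃a' b' : V⦄ (Q : T.Walk a' b'), Q.IsPath → l ∈ Q.support → InteriorDeg2 T Q →
      Q.length ≤ P.length

/-- The length (number of edges) of the twig of `l`: the maximal length of a path
in `T` containing `l` all of whose interior vertices have degree 2 in `T`. -/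
def twigLen [Fintype V] (T : SimpleGraph V) (l : V) : ℕ :=
  sSup {n : ℕ | ∃ (a b : V) (P : T.Walk a b),
    P.IsPath ∧ l ∈ P.support ∧ InteriorDeg2 T P ∧ P.length = n}

/-- The multiset of lengths of the twigs of `T` (one twig for each leaf). -/
def twigLengths [Fintype V] (T : SimpleGraph V) : Multiset ℕ :=
  (leaves T).val.map (twigLen T)

end

open SimpleGraph

/-- In a finite tree with at least one edge, the number of leaves is `2 + ∑ (deg v - 2)`, the sum
being over the vertices of degree at least two. -/
theorem SimpleGraph.IsTree.card_degree_eq_one {W : Type*} [Fintype W] [Nontrivial W]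
    {G : SimpleGraph W} (hG : G.IsTree) :
    (Finset.univ.filter fun v => G.degree v = 1).card = 2 + ∑ v, (G.degree v - 2) := by
  have hcard := hG.card_edgeFinset
  have hsum := G.sum_degrees_eq_twice_card_edges
  have hpoint : ∑ v, (G.degree v + if G.degree v = 1 then 1 else 0) =
      ∑ v, (2 + (G.degree v - 2)) := by
    refine Finset.sum_congr rfl fun v _ => ?_
    have := hG.connected.preconnected.degree_pos_of_nontrivial v
    split_ifs <;> omega
  rw [Finset.sum_add_distrib, Finset.sum_add_distrib, ← Finset.card_filter, hsum] at hpoint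
  simp only [Finset.sum_const, Finset.card_univ, smul_eq_mul] at hpoint
  omega

theorem degree_induce_eq_card {V : Type*} [Fintype V] (T : SimpleGraph V) (B : Finset V)
    (v : (B : Set V)) :
    (T.induce (B : Set V)).degree v = (T.neighborFinset v ∩ B).card := by
  rw [← card_neighborFinset_eq_degree, ← Finset.card_map (Function.Embedding.subtype _)]
  congr 1
  ext w
  simp [and_comm]

theorem leafCount_eq_two_add_sum {V : Type*} [Fintype V] {T : SimpleGraph V} (hT : T.IsAcyclic)
    {B : Finset V} (hB : IsSubtree T B) :
    leafCount T B = 2 + ∑ v, if v ∈ B then (T.neighborFinset v ∩ B).card - 2 else 0 := by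
  obtain ⟨hconn, u, hu, v, hv, huv⟩ := hB
  have : Nontrivial (B : Set V) := ⟨⟨u, hu⟩, ⟨v, hv⟩, fun h => huv.ne (congrArg Subtype.val h)⟩
  have htree : (T.induce (B : Set V)).IsTree := ⟨hconn, hT.induce _⟩
  have hleaf : leafCount T B =
      (Finset.univ.filter fun v => (T.induce (B : Set V)).degree v = 1).card := by
    simp only [leafCount, Nat.card_eq_fintype_card, card_neighborSet_eq_degree]
    rw [Fintype.card_subtype]
  have hsum : (Finset.univ.filter fun v => (T.induce (B : Set V)).degree v = 1).card =
      2 + ∑ v, ((T.induce (B : Set V)).degree v - 2) := by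
    convert htree.card_degree_eq_one
  rw [hleaf, hsum, Finset.sum_ite_mem, Finset.univ_inter]
  simp only [degree_induce_eq_card]
  rw [← Finset.sum_coe_sort B]
  rfl

/-- A subtree has as many leaves as the whole tree exactly when it contains every vertex of
degree at least three together with all its neighbors. -/
theorem leafCount_eq_card_leaves_iff {V : Type*} [Fintype V] {T : SimpleGraph V} (hT : T.IsTree)
    {B : Finset V} (hB : IsSubtree T B) :
    leafCount T B = (leaves T).card ↔
      ∀ v, 3 ≤ T.degree v → v ∈ B ∧ T.neighborFinset v ⊆ B := by
  have : Nontrivial V := by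
    obtain ⟨-, u, -, v, -, huv⟩ := hB
    exact ⟨u, v, huv.ne⟩
  rw [leafCount_eq_two_add_sum hT.isAcyclic hB, leaves, hT.card_degree_eq_one,
    Nat.add_left_cancel_iff]
  have hle (v : V) : (T.neighborFinset v ∩ B).card ≤ T.degree v := by
    rw [← card_neighborFinset_eq_degree]
    exact Finset.card_le_card Finset.inter_subset_left
  rw [Finset.sum_eq_sum_iff_of_le fun v _ => by have := hle v; split_ifs <;> omega]
  refine forall_congr' fun v => ?_
  simp only [Finset.mem_univ, true_imp_iff]
  have hv := hle v
  have hiff : (T.neighborFinset v ∩ B).card = T.degree v ↔ T.neighborFinset v ⊆ B := by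
    rw [← Finset.inter_eq_left, ← card_neighborFinset_eq_degree]
    exact ⟨Finset.eq_of_subset_of_card_le Finset.inter_subset_left ∘ Eq.ge, congrArg _⟩
  rw [← hiff]
  split_ifs with h
  · simp only [h, true_and]
    omega
  · simp only [h, false_and]
    constructor
    · intro h0 h3
      omega
    · intro h3
      have : ¬ 3 ≤ T.degree v := h3
      omega

/-- Only vertices of degree at least three of the trunk have neighbors outside of the trunk. -/
theorem IsTrunk.three_le_degree {V : Type*} [Fintype V] {T : SimpleGraph V}
    (hdeg : ∃ v : V, 3 ≤ T.degree v) {A : Finset V} (hA : IsTrunk T A) {u v : V} (hu : u ∈ A)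
    (hv : v ∉ A) (huv : T.Adj u v) : 3 ≤ T.degree u := by
  by_contra hlt
  obtain ⟨hconn, hmem, hmin⟩ := hA
  obtain ⟨w, hw⟩ := hdeg
  have hwu : w ≠ u := by rintro rfl; exact hlt hw
  have : Nontrivial (A : Set V) :=
    ⟨⟨w, hmem w hw⟩, ⟨u, hu⟩, fun h => hwu (congrArg Subtype.val h)⟩
  have hpos := hconn.preconnected.degree_pos_of_nontrivial ⟨u, hu⟩
  have hsub : (T.neighborFinset u ∩ A).card < T.degree u := by
    rw [← card_neighborFinset_eq_degree]
    refine Finset.card_lt_card (Finset.ssubset_iff_of_subset Finset.inter_subset_left |>.2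
      ⟨v, by simpa using huv, by simp [hv]⟩)
  have hone : (T.induce (A : Set V)).degree ⟨u, hu⟩ = 1 := by
    have := degree_induce_eq_card T A ⟨u, hu⟩
    simp only at this
    omega
  have hconn' := hconn.induce_compl_singleton_of_degree_eq_one hone
  have herase : (T.induce ((A.erase u : Finset V) : Set V)).Connected := by
    let f : (T.induce (A : Set V)).induce {⟨u, hu⟩}ᶜ →g
        T.induce ((A.erase u : Finset V) : Set V) :=
      { toFun := fun x => ⟨x.1.1, by
          have h := x.2
          rw [Set.mem_compl_singleton_iff] at h
          exact Finset.mem_coe.2 (Finset.mem_erase.2 ⟨fun e => h (Subtype.ext e), x.1.2⟩)⟩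
        map_rel' := fun h => h }
    refine hconn'.map f fun x => ?_
    obtain ⟨x, hx⟩ := x
    have hx' := Finset.mem_erase.1 (Finset.mem_coe.1 hx)
    exact ⟨⟨⟨x, hx'.2⟩, fun e => hx'.1 (congrArg Subtype.val e)⟩, rfl⟩
  have := hmin (A.erase u) herase fun x hx =>
    Finset.mem_erase.2 ⟨by rintro rfl; exact hlt hx, hmem x hx⟩
  simpa using this hu

/-- In an acyclic graph, a path starting in a set inducing a connected subgraph and leaving that
set in the first step never returns to it. -/
theorem SimpleGraph.IsAcyclic.notMem_of_mem_support {V : Type*} {T : SimpleGraph V}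
    (hT : T.IsAcyclic) {A : Set V} (hA : (T.induce A).Connected) {u v l : V} (hu : u ∈ A)
    (hv : v ∉ A) (huv : T.Adj u v) {p : T.Walk v l} (hp : (Walk.cons huv p).IsPath) {w : V}
    (hw : w ∈ p.support) : w ∉ A := by
  intro hwA
  obtain ⟨q, hq⟩ := hA.exists_isPath ⟨u, hu⟩ ⟨w, hwA⟩
  have hq' := hq.map (f := (Embedding.induce A).toHom) Subtype.val_injective
  have hr : (Walk.cons huv (p.takeUntil w hw)).IsPath := by
    rw [Walk.cons_isPath_iff] at hp ⊢
    exact ⟨hp.1.takeUntil hw, fun h => hp.2 (p.support_takeUntil_subset_support hw h)⟩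
  have heq := congrArg Subtype.val ((hT.subsingleton_path u w).elim ⟨_, hq'⟩ ⟨_, hr⟩)
  simp only at heq
  have hmem : v ∈ (Walk.cons huv (p.takeUntil w hw)).support := by simp
  have hmem' : v ∈ q.support.map (Embedding.induce (G := T) A).toHom := by
    rw [← Walk.support_map]
    exact (congrArg (v ∈ Walk.support ·) heq).mpr hmem
  obtain ⟨x, -, rfl⟩ := List.mem_map.1 hmem'
  exact hv x.2

/-- Two paths out of the same leaf whose interior vertices have degree two agree as long as both
of them last. -/
theorem InteriorDeg2.getVert_eq {V : Type*} [Fintype V] {T : SimpleGraph V} {l u w : V}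
    (hl : T.degree l = 1) {P : T.Walk l u} {Q : T.Walk l w} (hP : P.IsPath) (hQ : Q.IsPath)
    (hPd : InteriorDeg2 T P) (i : ℕ) (hiP : i ≤ P.length) (hiQ : i ≤ Q.length) :
    P.getVert i = Q.getVert i := by
  induction i using Nat.strong_induction_on with
  | _ i ih =>
  match i with
  | 0 => simp
  | 1 =>
    obtain ⟨x, -, hx⟩ := degree_eq_one_iff_existsUnique_adj.1 hl
    have h1 := P.adj_getVert_succ (i := 0) (by omega)
    have h2 := Q.adj_getVert_succ (i := 0) (by omega)
    rw [Walk.getVert_zero] at h1 h2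
    exact (hx _ h1).trans (hx _ h2).symm
  | i + 2 =>
    have e0 := ih i (by omega) (by omega) (by omega)
    have e1 := ih (i + 1) (by omega) (by omega) (by omega)
    have h0 := P.adj_getVert_succ (i := i) (by omega)
    have h1 := P.adj_getVert_succ (i := i + 1) (by omega)
    have h2 := Q.adj_getVert_succ (i := i + 1) (by omega)
    rw [← e1] at h2
    have hd : T.degree (P.getVert (i + 1)) = 2 := by
      refine hPd _ (P.getVert_mem_support _) (fun h => ?_) (fun h => ?_)
      · rw [hP.getVert_eq_start_iff (by omega)] at h; omega
      · rw [hP.getVert_eq_end_iff (by omega)] at h; omega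
    have n1 : P.getVert (i + 2) ≠ P.getVert i := fun h => by
      have := hP.getVert_injOn (x₁ := i + 2) (x₂ := i) hiP (show i ≤ P.length by omega) h
      omega
    have n2 : Q.getVert (i + 2) ≠ P.getVert i := fun h => by
      rw [e0] at h
      have := hQ.getVert_injOn (x₁ := i + 2) (x₂ := i) hiQ (show i ≤ Q.length by omega) h
      omega
    by_contra hne
    have hsub : ({P.getVert i, P.getVert (i + 2), Q.getVert (i + 2)} : Finset V) ⊆
        T.neighborFinset (P.getVert (i + 1)) := by
      intro x hx
      simp only [Finset.mem_insert, Finset.mem_singleton] at hx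
      rw [mem_neighborFinset]
      rcases hx with rfl | rfl | rfl
      exacts [h0.symm, h1, h2]
    have := Finset.card_le_card hsub
    rw [card_neighborFinset_eq_degree, hd, Finset.card_eq_three.2
      ⟨_, _, _, n1.symm, n2.symm, hne, rfl⟩] at this
    omega

/-- A path from a leaf to a vertex of degree at least three all of whose interior vertices have
degree two is the twig of that leaf. -/
theorem InteriorDeg2.isTwig {V : Type*} [Fintype V] {T : SimpleGraph V} {l u : V}
    (hl : T.degree l = 1) (hu : 3 ≤ T.degree u) {P : T.Walk l u} (hP : P.IsPath)
    (hPd : InteriorDeg2 T P) : IsTwig T l P := by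
  have key : ∀ ⦃b : V⦄ (Q : T.Walk l b), Q.IsPath → InteriorDeg2 T Q → Q.length ≤ P.length := by
    intro b Q hQ hQd
    by_contra! hlt
    have h := hPd.getVert_eq hl hP hQ P.length le_rfl hlt.le
    rw [Walk.getVert_length] at h
    have := hQd u (h ▸ Q.getVert_mem_support _) (by rintro rfl; omega) (by
      rintro rfl
      have := (hQ.getVert_eq_end_iff hlt.le).1 h.symm
      omega)
    omega
  refine ⟨hP, P.start_mem_support, hPd, fun a b Q hQ hlQ hQd => ?_⟩
  by_cases hla : l = a
  · subst hla
    exact key Q hQ hQd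
  by_cases hlb : l = b
  · subst hlb
    rw [← Q.length_reverse]
    exact key Q.reverse hQ.reverse fun x hx h1 h2 => hQd x (by simpa using hx) h2 h1
  have := hQd l hlQ hla hlb
  omega

/-- Every interior vertex of a path has degree at least two. -/
theorem SimpleGraph.Walk.IsPath.two_le_degree {V : Type*} [Fintype V] {T : SimpleGraph V}
    {a b : V} {P : T.Walk a b} (hP : P.IsPath) {x : V} (hx : x ∈ P.support) (hxa : x ≠ a)
    (hxb : x ≠ b) : 2 ≤ T.degree x := by
  obtain ⟨n, rfl, hn⟩ := Walk.mem_support_iff_exists_getVert.1 hx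
  have hn0 : n ≠ 0 := by rintro rfl; simp at hxa
  have hnl : n ≠ P.length := by rintro rfl; simp at hxb
  obtain ⟨m, rfl⟩ := Nat.exists_eq_succ_of_ne_zero hn0
  have h0 := P.adj_getVert_succ (i := m) (by omega)
  have h1 := P.adj_getVert_succ (i := m + 1) (by omega)
  have hne : P.getVert m ≠ P.getVert (m + 2) := fun h => by
    have := hP.getVert_injOn (x₁ := m) (x₂ := m + 2) (show m ≤ P.length by omega)
      (show m + 2 ≤ P.length by omega) h
    omega
  rw [← card_neighborFinset_eq_degree, ← Finset.card_pair hne]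
  refine Finset.card_le_card fun y hy => ?_
  simp only [Finset.mem_insert, Finset.mem_singleton] at hy
  rw [mem_neighborFinset]
  rcases hy with rfl | rfl
  exacts [h0.symm, h1]

/-- In a finite acyclic graph, every edge `uv` can be prolonged beyond `v` to a path ending in a
leaf. -/
theorem SimpleGraph.IsAcyclic.exists_isPath_cons_degree_eq_one {V : Type*} [Fintype V]
    {T : SimpleGraph V} (hT : T.IsAcyclic) {u v : V} (huv : T.Adj u v) :
    ∃ (l : V) (p : T.Walk v l), (Walk.cons huv p).IsPath ∧ T.degree l = 1 := by
  let s : Set ℕ := {n | ∃ (l : V) (p : T.Walk v l), (Walk.cons huv p).IsPath ∧ p.length = n}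
  have hs : s.Finite := by
    refine (Set.finite_lt_nat (Fintype.card V)).subset ?_
    rintro n ⟨l, p, hp, rfl⟩
    exact hp.of_cons.length_lt
  have hne : s.Nonempty := ⟨0, v, Walk.nil, by simp [huv.ne], rfl⟩
  obtain ⟨_, ⟨⟨l, p, hp, rfl⟩, hmax⟩⟩ := hs.exists_maximal hne
  refine ⟨l, p, hp, degree_eq_one_iff_existsUnique_adj.2
    ⟨(Walk.cons huv p).penultimate, ((Walk.cons huv p).adj_penultimate (by simp)).symm, ?_⟩⟩
  intro y hy
  refine hT.eq_penultimate_of_adj_end hp hy ?_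
  by_contra hys
  have hlong : (Walk.cons huv (p.concat hy)).IsPath := by
    rw [← Walk.concat_cons]
    exact hp.concat hys hy
  have := hmax ⟨y, p.concat hy, hlong, rfl⟩ (by simp)
  simp at this

/-- Every vertex adjacent to the trunk but not in it lies on a twig ending at the trunk. -/
theorem IsTrunk.exists_isTwig {V : Type*} [Fintype V] {T : SimpleGraph V} (hT : T.IsAcyclic)
    (hdeg : ∃ v : V, 3 ≤ T.degree v) {A : Finset V} (hA : IsTrunk T A) {u v : V} (hu : u ∈ A)
    (hv : v ∉ A) (huv : T.Adj u v) :
    ∃ (l : V) (P : T.Walk l u), T.degree l = 1 ∧ IsTwig T l P ∧ v ∈ P.support := by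
  obtain ⟨l, p, hp, hl⟩ := hT.exists_isPath_cons_degree_eq_one huv
  refine ⟨l, (Walk.cons huv p).reverse, hl, InteriorDeg2.isTwig hl
    (hA.three_le_degree hdeg hu hv huv) hp.reverse fun x hx hxl hxu => ?_, by simp⟩
  rw [Walk.support_reverse, List.mem_reverse] at hx
  have h2 := hp.two_le_degree hx hxu hxl
  have hxp : x ∈ p.support := by
    rw [Walk.support_cons, List.mem_cons] at hx
    exact hx.resolve_left hxu
  have hxA : x ∉ (A : Set V) :=
    hT.notMem_of_mem_support hA.1 (Finset.mem_coe.2 hu) (by simpa using hv) huv hp hxp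
  have : ¬ 3 ≤ T.degree x := fun h => hxA (hA.2.1 x h)
  omega

theorem stmt8 {V : Type*} [Fintype V]
    (T : SimpleGraph V) (hT : T.IsTree) (hdeg : ∃ v : V, 3 ≤ T.degree v)
    (a : ℕ) (ha : (leaves T).card = a) (A : Finset V) (hA : IsTrunk T A)
    (U : Finset V)
    (hU : ∀ v : V, v ∈ U ↔ v ∈ A ∨
      ∃ (l u : V) (P : T.Walk l u), T.degree l = 1 ∧ IsTwig T l P ∧
        u ∈ A ∧ T.Adj u v ∧ v ∈ P.support) :
    (IsSubtree T U ∧ leafCount T U = a) ∧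
      (∀ B : Finset V, IsSubtree T B → leafCount T B = a → U ⊆ B) ∧
      (∀ B : Finset V, IsSubtree T B → leafCount T B = a → B.card ≤ U.card → B = U) := by
  subst ha
  have hU' (v : V) : v ∈ U ↔ v ∈ A ∨ ∃ u ∈ A, T.Adj u v := by
    rw [hU]
    constructor
    · rintro (h | ⟨l, u, P, -, -, hu, huv, -⟩)
      exacts [Or.inl h, Or.inr ⟨u, hu, huv⟩]
    · rintro (h | ⟨u, hu, huv⟩)
      · exact Or.inl h
      · by_cases hv : v ∈ A
        · exact Or.inl hv
        · obtain ⟨l, P, hl, hP, hvP⟩ := hA.exists_isTwig hT.isAcyclic hdeg hu hv huv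
          exact Or.inr ⟨l, u, P, hl, hP, hu, huv, hvP⟩
  have hAU : A ⊆ U := fun v hv => (hU' v).2 (Or.inl hv)
  have hsub (B : Finset V) (hB : IsSubtree T B) (hBa : leafCount T B = (leaves T).card) :
      U ⊆ B := by
    rw [leafCount_eq_card_leaves_iff hT hB] at hBa
    have hAB : A ⊆ B := hA.2.2 B hB.1 fun v hv => (hBa v hv).1
    intro v hv
    by_cases hvA : v ∈ A
    · exact hAB hvA
    · obtain ⟨u, hu, huv⟩ := ((hU' v).1 hv).resolve_left hvA
      exact (hBa u (hA.three_le_degree hdeg hu hvA huv)).2 (by simpa using huv)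
  have hUsub : IsSubtree T U := by
    obtain ⟨w, hw⟩ := hdeg
    have hwA := hA.2.1 w hw
    constructor
    · refine T.induce_connected_of_patches w (hAU hwA) fun {v} hv => ?_
      rcases (hU' v).1 hv with hvA | ⟨u, hu, huv⟩
      · exact ⟨A, hAU, hwA, hvA, hA.1.preconnected _ _⟩
      · refine ⟨(A : Set V) ∪ {u, v}, ?_, Or.inl hwA, Or.inr (by simp), ?_⟩
        · rintro x (hx | rfl | rfl)
          exacts [hAU hx, hAU hu, hv]
        · exact (T.induce_union_connected hA.1.preconnected
            (T.induce_pair_connected_of_adj huv).preconnected ⟨u, hu, by simp⟩).preconnected _ _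
    · obtain ⟨x, hx⟩ := (T.degree_pos_iff_exists_adj w).1 (by omega)
      exact ⟨w, hAU hwA, x, (hU' x).2 (Or.inr ⟨w, hwA, hx⟩), hx⟩
  refine ⟨⟨hUsub, (leafCount_eq_card_leaves_iff hT hUsub).2 fun v hv => ?_⟩, hsub,
    fun B hB hBa hcard => (Finset.eq_of_subset_of_card_le (hsub B hB hBa) hcard).symm⟩
  have hvA := hA.2.1 v hv
  exact ⟨hAU hvA, fun x hx => (hU' x).2 (Or.inr ⟨v, hvA, by simpa using hx⟩)⟩
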